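/- Let G = (V, E) be a finite simple graph, let k ≥ 4 be an integer, set t = C(k,2) − k − 1, let H be the bipartite Hall-set construction for (G, k) with parts A and B = V ∪ U, and let G' be the 2-subdivision of H with bipartition (A', B') where A ⊆ A' and B ⊆ B'. Let S' ⊆ A' be a nonempty set such that for every v ∈ A, either S' ∩ ({v} ∪ N²_{G'}(v)) = ∅ or {v} ∪ N²_{G'}(v) ⊆ S'. Then |S'| = (3 + t)·|S' ∩ A| and |N_{G'}(S')| = (2 + t)·|S' ∩ A| + t + |V ∩ N_{G'}(S')|, where V ∩ N_{G'}(S') is exactly the set of vertices of V that are an endpoint of some edge e of G with v_e ∈ S'. -/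

import Mathlib

variable {V : Type*}

/-- `S` is a vertex cover of `G`: every edge has at least one endpoint in `S`. -/
def IsVertexCover (G : SimpleGraph V) (S : Set V) : Prop :=
  ∀ ⦃u v : V⦄, G.Adj u v → u ∈ S ∨ v ∈ S

/-- `S` is an independent set of `G`: no edge has both endpoints in `S`. -/
def IsIndepSet (G : SimpleGraph V) (S : Set V) : Prop :=
  ∀ ⦃u : V⦄, u ∈ S → ∀ ⦃v : V⦄, v ∈ S → ¬ G.Adj u v

/-- `nbhd G S = N(S)`: vertices outside `S` adjacent to at least one vertex of `S`. -/
def nbhd (G : SimpleGraph V) (S : Set V) : Set V :=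
  {v : V | v ∉ S ∧ ∃ s ∈ S, G.Adj s v}

/-- Vertex set of the Hall-set construction: `A = {vₑ : e ∈ E}` (left summand) and
`B = V ∪ U` with `|U| = t` (right summand). -/
abbrev HallV (G : SimpleGraph V) (t : ℕ) : Type _ := ↥G.edgeSet ⊕ (V ⊕ Fin t)

/-- The bipartite graph of the Hall-set construction: `vₑ` is adjacent to both endpoints
of `e` and to every vertex of `U`; there are no other edges. -/
def hallGraph (G : SimpleGraph V) (t : ℕ) : SimpleGraph (HallV G t) :=
  SimpleGraph.fromRel (fun x y =>
    ∃ e : G.edgeSet, x = Sum.inl e ∧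
      ((∃ v : V, y = Sum.inr (Sum.inl v) ∧ v ∈ (e : Sym2 V)) ∨
       (∃ u : Fin t, y = Sum.inr (Sum.inr u))))

/-- Vertex set of the 2-subdivision: the original vertices plus, for each edge `xy`,
the two new vertices `z_{xy}` and `z'_{xy}`, encoded as the darts `(x,y)` and `(y,x)`. -/
abbrev SubdivV (G : SimpleGraph V) : Type _ := V ⊕ {p : V × V // G.Adj p.1 p.2}

/-- The 2-subdivision of `G`: each edge `xy` is replaced by the path
`x — z_{xy} — z'_{xy} — y`, where `z_{xy}` is the dart `(x,y)` and `z'_{xy}` the dart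
`(y,x)`; a dart is adjacent to its first coordinate and to the reverse dart. -/
def subdiv2 (G : SimpleGraph V) : SimpleGraph (SubdivV G) :=
  SimpleGraph.fromRel (fun x y =>
    (∃ d : {p : V × V // G.Adj p.1 p.2}, x = Sum.inl d.val.1 ∧ y = Sum.inr d) ∨
    (∃ d d' : {p : V × V // G.Adj p.1 p.2},
      x = Sum.inr d ∧ y = Sum.inr d' ∧ d.val.1 = d'.val.2 ∧ d.val.2 = d'.val.1))

/-- `N²(S)`: the set of vertices at distance exactly 2 from some vertex of `S`. -/
def nbhd2 (G : SimpleGraph V) (S : Set V) : Set V :=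
  {w : V | ∃ s ∈ S, G.dist s w = 2}

/-- The part `A' = A ∪ {z'_{ab} : ab ∈ E(H)}` of the bipartition of the 2-subdivision of
the Hall-set construction graph (`z'_{ab}`, the subdivision vertex adjacent to `b ∈ B`,
is the dart whose first coordinate lies in `B`). -/
def hallA' (G : SimpleGraph V) (t : ℕ) : Set (SubdivV (hallGraph G t)) :=
  {x | (∃ e : G.edgeSet, x = Sum.inl (Sum.inl e)) ∨
       (∃ d : {p : HallV G t × HallV G t // (hallGraph G t).Adj p.1 p.2},
          x = Sum.inr d ∧ ∃ w : V ⊕ Fin t, d.val.1 = Sum.inr w)}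

/-- The vertices of `B` adjacent in the Hall-set construction to `vₑ`. -/
def HallInc (G : SimpleGraph V) (t : ℕ) (e : G.edgeSet) (w : V ⊕ Fin t) : Prop :=
  Sum.elim (fun v => v ∈ (e : Sym2 V)) (fun _ => True) w

theorem hallGraph_adj_inl_inr {G : SimpleGraph V} {t : ℕ} {e : G.edgeSet} {w : V ⊕ Fin t} :
    (hallGraph G t).Adj (Sum.inl e) (Sum.inr w) ↔ HallInc G t e w := by
  rcases w with v | u <;> simp [hallGraph, HallInc]

theorem hallGraph_adj_inr_inl {G : SimpleGraph V} {t : ℕ} {e : G.edgeSet} {w : V ⊕ Fin t} :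
    (hallGraph G t).Adj (Sum.inr w) (Sum.inl e) ↔ HallInc G t e w := by
  rw [SimpleGraph.adj_comm, hallGraph_adj_inl_inr]

theorem not_hallGraph_adj_inl_inl {G : SimpleGraph V} {t : ℕ} {e f : G.edgeSet} :
    ¬ (hallGraph G t).Adj (Sum.inl e) (Sum.inl f) := by
  simp [hallGraph]

theorem not_hallGraph_adj_inr_inr {G : SimpleGraph V} {t : ℕ} {w x : V ⊕ Fin t} :
    ¬ (hallGraph G t).Adj (Sum.inr w) (Sum.inr x) := by
  simp [hallGraph]

theorem not_subdiv2_adj_inl_inl {G : SimpleGraph V} {x y : V} :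
    ¬ (subdiv2 G).Adj (Sum.inl x) (Sum.inl y) := by
  simp [subdiv2]

theorem subdiv2_adj_inl_inr {G : SimpleGraph V} {x : V} {d : {p : V × V // G.Adj p.1 p.2}} :
    (subdiv2 G).Adj (Sum.inl x) (Sum.inr d) ↔ x = d.val.1 := by
  simp only [subdiv2, SimpleGraph.fromRel_adj]
  constructor
  · rintro ⟨-, (⟨d', h1, h2⟩ | ⟨d', d'', h1, -⟩) | (⟨d', h1, h2⟩ | ⟨d', d'', -, h1, -⟩)⟩
    · cases h2; exact Sum.inl.inj h1
    all_goals cases h1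
  · rintro rfl
    exact ⟨Sum.inl_ne_inr, Or.inl (Or.inl ⟨d, rfl, rfl⟩)⟩

theorem subdiv2_adj_inr_inr {G : SimpleGraph V} {d d' : {p : V × V // G.Adj p.1 p.2}} :
    (subdiv2 G).Adj (Sum.inr d) (Sum.inr d') ↔ d.val.1 = d'.val.2 ∧ d.val.2 = d'.val.1 := by
  simp only [subdiv2, SimpleGraph.fromRel_adj]
  constructor
  · rintro ⟨-, (⟨a, h1, -⟩ | ⟨a, b, h1, h2, h3, h4⟩) | (⟨a, h1, -⟩ | ⟨a, b, h1, h2, h3, h4⟩)⟩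
    · cases h1
    · cases h1; cases h2; exact ⟨h3, h4⟩
    · cases h1
    · cases h1; cases h2; exact ⟨h4.symm, h3.symm⟩
  · rintro ⟨h1, h2⟩
    refine ⟨fun h => ?_, Or.inl (Or.inr ⟨d, d', rfl, rfl, h1, h2⟩)⟩
    cases h
    exact G.ne_of_adj d.2 h1

theorem mem_nbhd2_subdiv2_singleton {G : SimpleGraph V} {x : V} {y : SubdivV G} :
    y ∈ nbhd2 (subdiv2 G) {Sum.inl x} ↔
      ∃ d : {p : V × V // G.Adj p.1 p.2}, y = Sum.inr d ∧ d.val.2 = x := by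
  simp only [nbhd2, Set.mem_singleton_iff, exists_eq_left, Set.mem_ofPred_eq]
  constructor
  · intro h
    have hr : (subdiv2 G).Reachable (Sum.inl x) y := by
      by_contra hn
      rw [SimpleGraph.dist_eq_zero_of_not_reachable hn] at h
      omega
    obtain ⟨p, hp⟩ := hr.exists_walk_length_eq_dist
    rw [h] at hp
    match p, hp with
    | .cons (v := z) h1 (.cons h2 .nil), _ =>
      rcases z with z | d
      · exact absurd h1 not_subdiv2_adj_inl_inl
      rw [subdiv2_adj_inl_inr] at h1
      rcases y with y | d'
      · rw [SimpleGraph.adj_comm, subdiv2_adj_inl_inr] at h2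
        rw [h1, h2, SimpleGraph.dist_self] at h
        omega
      · exact ⟨d', rfl, by rw [h1, (subdiv2_adj_inr_inr.1 h2).1]⟩
  · rintro ⟨d, rfl, rfl⟩
    have h1 : (subdiv2 G).Adj (Sum.inl d.val.2) (Sum.inr ⟨(d.val.2, d.val.1), d.2.symm⟩) :=
      subdiv2_adj_inl_inr.2 rfl
    have h2 : (subdiv2 G).Adj (Sum.inr ⟨(d.val.2, d.val.1), d.2.symm⟩) (Sum.inr d) :=
      subdiv2_adj_inr_inr.2 ⟨rfl, rfl⟩
    have hle := SimpleGraph.dist_le (SimpleGraph.Walk.cons h1 (.cons h2 .nil))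
    have h0 : (subdiv2 G).dist (Sum.inl d.val.2) (Sum.inr d) ≠ 0 := fun h =>
      Sum.inl_ne_inr (((h1.reachable.trans h2.reachable).dist_eq_zero_iff).1 h)
    have hone : (subdiv2 G).dist (Sum.inl d.val.2) (Sum.inr d) ≠ 1 := fun h =>
      G.ne_of_adj d.2 (subdiv2_adj_inl_inr.1 (SimpleGraph.dist_eq_one_iff_adj.1 h)).symm
    simp only [SimpleGraph.Walk.length_cons, SimpleGraph.Walk.length_nil] at hle
    omega

theorem card_hallInc (G : SimpleGraph V) (t : ℕ) (e : G.edgeSet) :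
    Nat.card {w // HallInc G t e w} = 2 + t := by
  have h2 : Nat.card {v // v ∈ (e : Sym2 V)} = 2 := by
    obtain ⟨⟨a, b⟩, he⟩ := e
    have hab : a ≠ b := G.ne_of_adj he
    rw [← Set.ncard_pair hab, ← Nat.card_coe_set_eq]
    exact Nat.card_congr (Equiv.subtypeEquivRight fun v => Sym2.mem_iff)
  have : Finite {v // v ∈ (e : Sym2 V)} := Nat.finite_of_card_ne_zero (by omega)
  rw [Nat.card_congr (Equiv.subtypeSum (p := HallInc G t e))]
  change Nat.card ({v // v ∈ (e : Sym2 V)} ⊕ {_u : Fin t // True}) = _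
  rw [Nat.card_sum, h2]
  simp

/-- The vertices `z_{ab}` with `a = vₑ` for some `e ∈ F`. -/
def hallZ (G : SimpleGraph V) (t : ℕ) (F : Set G.edgeSet)
    (p : Σ e : F, {w // HallInc G t e w}) : SubdivV (hallGraph G t) :=
  Sum.inr ⟨(Sum.inl p.1, Sum.inr p.2), hallGraph_adj_inl_inr.2 p.2.2⟩

/-- The vertices `z'_{ab}` with `a = vₑ` for some `e ∈ F`. -/
def hallZ' (G : SimpleGraph V) (t : ℕ) (F : Set G.edgeSet)
    (p : Σ e : F, {w // HallInc G t e w}) : SubdivV (hallGraph G t) :=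
  Sum.inr ⟨(Sum.inr p.2, Sum.inl p.1), hallGraph_adj_inr_inl.2 p.2.2⟩

theorem hallZ_injective (G : SimpleGraph V) (t : ℕ) (F : Set G.edgeSet) :
    Function.Injective (hallZ G t F) := by
  rintro ⟨⟨e, he⟩, w, hw⟩ ⟨⟨f, hf⟩, x, hx⟩ h
  simp only [hallZ, Sum.inr.injEq, Subtype.mk.injEq, Prod.mk.injEq, Sum.inl.injEq] at h
  obtain ⟨rfl, rfl⟩ := h
  rfl

theorem hallZ'_injective (G : SimpleGraph V) (t : ℕ) (F : Set G.edgeSet) :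
    Function.Injective (hallZ' G t F) := by
  rintro ⟨⟨e, he⟩, w, hw⟩ ⟨⟨f, hf⟩, x, hx⟩ h
  simp only [hallZ', Sum.inr.injEq, Subtype.mk.injEq, Prod.mk.injEq, Sum.inl.injEq] at h
  obtain ⟨rfl, rfl⟩ := h
  rfl

theorem card_sigma_hallInc [Finite V] (G : SimpleGraph V) (t : ℕ) (F : Set G.edgeSet) :
    Nat.card (Σ e : F, {w // HallInc G t e w}) = (2 + t) * F.ncard := by
  have := Fintype.ofFinite F
  rw [Nat.card_sigma]
  simp only [card_hallInc, Finset.sum_const, smul_eq_mul, Finset.card_univ]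
  rw [← Nat.card_eq_fintype_card, Nat.card_coe_set_eq, mul_comm]

/-- in the 2-subdivision `G'` of the Hall-set construction, if `S' ⊆ A'` is
nonempty and for every `v ∈ A` either `S' ∩ ({v} ∪ N²(v)) = ∅` or `{v} ∪ N²(v) ⊆ S'`,
then `|S'| = (3 + t)·|S' ∩ A|` and
`|N_{G'}(S')| = (2 + t)·|S' ∩ A| + t + |V ∩ N_{G'}(S')|`, where `V ∩ N_{G'}(S')` is
exactly the set of endpoints of edges `e` of `G` with `vₑ ∈ S'`. -/
theorem stmt9 [Fintype V] (G : SimpleGraph V) (k t : ℕ) (hk : 4 ≤ k)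
    (ht : t = k.choose 2 - k - 1)
    (S' : Set (SubdivV (hallGraph G t))) (hne : S'.Nonempty)
    (hSA' : S' ⊆ hallA' G t)
    (hcl : ∀ e : G.edgeSet,
      S' ∩ ({Sum.inl (Sum.inl e)} ∪
        nbhd2 (subdiv2 (hallGraph G t)) {Sum.inl (Sum.inl e)}) = ∅ ∨
      ({Sum.inl (Sum.inl e)} ∪
        nbhd2 (subdiv2 (hallGraph G t)) {Sum.inl (Sum.inl e)}) ⊆ S') :
    S'.ncard = (3 + t) *
        (S' ∩ {x : SubdivV (hallGraph G t) | ∃ e : G.edgeSet, x = Sum.inl (Sum.inl e)}).ncard ∧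
      (nbhd (subdiv2 (hallGraph G t)) S').ncard = (2 + t) *
        (S' ∩ {x : SubdivV (hallGraph G t) | ∃ e : G.edgeSet, x = Sum.inl (Sum.inl e)}).ncard +
        t + ({v : V | Sum.inl (Sum.inr (Sum.inl v)) ∈ nbhd (subdiv2 (hallGraph G t)) S'}).ncard ∧
      {v : V | Sum.inl (Sum.inr (Sum.inl v)) ∈ nbhd (subdiv2 (hallGraph G t)) S'} =
        {v : V | ∃ e : G.edgeSet, Sum.inl (Sum.inl e) ∈ S' ∧ v ∈ (e : Sym2 V)} := by
  set F : Set G.edgeSet := {e | Sum.inl (Sum.inl e) ∈ S'}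
  have hSA : S' ∩ {x | ∃ e : G.edgeSet, x = Sum.inl (Sum.inl e)} =
      (fun e : G.edgeSet => (Sum.inl (Sum.inl e) : SubdivV (hallGraph G t))) '' F := by
    ext x
    constructor
    · rintro ⟨hx, e, rfl⟩
      exact ⟨e, hx, rfl⟩
    · rintro ⟨e, he, rfl⟩
      exact ⟨he, e, rfl⟩
  have hinj : Function.Injective
      (fun e : G.edgeSet => (Sum.inl (Sum.inl e) : SubdivV (hallGraph G t))) :=
    Sum.inl_injective.comp Sum.inl_injective
  have hz : ∀ (e : G.edgeSet) (w : V ⊕ Fin t)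
      (h : (hallGraph G t).Adj (Sum.inr w) (Sum.inl e)),
      Sum.inr ⟨(Sum.inr w, Sum.inl e), h⟩ ∈ S' ↔ e ∈ F := by
    intro e w h
    have hmem : (Sum.inr ⟨(Sum.inr w, Sum.inl e), h⟩ : SubdivV (hallGraph G t)) ∈
        nbhd2 (subdiv2 (hallGraph G t)) {Sum.inl (Sum.inl e)} :=
      mem_nbhd2_subdiv2_singleton.2 ⟨_, rfl, rfl⟩
    rcases hcl e with hc | hc
    · constructor <;> intro h'
      · exact absurd (show _ ∈ S' ∩ _ from ⟨h', Or.inr hmem⟩) (hc ▸ Set.notMem_empty _)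
      · exact absurd (show _ ∈ S' ∩ _ from ⟨h', Or.inl rfl⟩) (hc ▸ Set.notMem_empty _)
    · exact ⟨fun _ => hc (Or.inl rfl), fun _ => hc (Or.inr hmem)⟩
  have hB : ∀ w, Sum.inl (Sum.inr w) ∉ S' := by
    intro w hw
    rcases hSA' hw with ⟨e, he⟩ | ⟨d, hd, -⟩
    · cases he
    · cases hd
  have hZ : ∀ e w h, Sum.inr ⟨(Sum.inl e, Sum.inr w), h⟩ ∉ S' := by
    intro e w h hw
    rcases hSA' hw with ⟨e, he⟩ | ⟨d, hd, x, hx⟩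
    · cases he
    · cases hd; cases hx
  have hS : S' = (fun e : G.edgeSet => (Sum.inl (Sum.inl e) : SubdivV (hallGraph G t))) '' F ∪
      Set.range (hallZ' G t F) := by
    ext x
    constructor
    · intro hx
      rcases x with (e | w) | ⟨⟨e | w, f | x⟩, h⟩
      · exact Or.inl ⟨e, hx, rfl⟩
      · exact absurd hx (hB w)
      · exact absurd h not_hallGraph_adj_inl_inl
      · exact absurd hx (hZ _ _ _)
      · exact Or.inr ⟨⟨⟨f, (hz _ _ _).1 hx⟩, w, hallGraph_adj_inr_inl.1 h⟩, rfl⟩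
      · exact absurd h not_hallGraph_adj_inr_inr
    · rintro (⟨e, he, rfl⟩ | ⟨⟨⟨e, he⟩, w, hw⟩, rfl⟩)
      · exact he
      · exact (hz _ _ _).2 he
  have hBN : ∀ w, Sum.inl (Sum.inr w) ∈ nbhd (subdiv2 (hallGraph G t)) S' ↔
      ∃ e ∈ F, HallInc G t e w := by
    intro w
    constructor
    · rintro ⟨-, s, hs, hadj⟩
      rw [hS] at hs
      rcases hs with ⟨e, he, rfl⟩ | ⟨⟨⟨e, he⟩, x, hx⟩, rfl⟩
      · exact absurd hadj not_subdiv2_adj_inl_inl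
      · rw [SimpleGraph.adj_comm, hallZ', subdiv2_adj_inl_inr] at hadj
        cases hadj
        exact ⟨e, he, hx⟩
    · rintro ⟨e, he, hw⟩
      refine ⟨hB w, _, (hz e w (hallGraph_adj_inr_inl.2 hw)).2 he, ?_⟩
      rw [SimpleGraph.adj_comm, subdiv2_adj_inl_inr]
  have hFne : F.Nonempty := by
    obtain ⟨x, hx⟩ := hne
    rw [hS] at hx
    rcases hx with ⟨e, he, -⟩ | ⟨⟨⟨e, he⟩, -⟩, -⟩ <;> exact ⟨e, he⟩
  have hN : nbhd (subdiv2 (hallGraph G t)) S' = Set.range (hallZ G t F) ∪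
      (Set.range (fun u : Fin t => (Sum.inl (Sum.inr (Sum.inr u)) : SubdivV (hallGraph G t))) ∪
      (fun v : V => (Sum.inl (Sum.inr (Sum.inl v)) : SubdivV (hallGraph G t))) ''
        {v : V | Sum.inl (Sum.inr (Sum.inl v)) ∈ nbhd (subdiv2 (hallGraph G t)) S'}) := by
    ext x
    constructor
    · intro hx
      rcases x with (e | v | u) | ⟨⟨e | w, f | x⟩, h⟩
      · obtain ⟨hx, s, hs, hadj⟩ := hx
        rw [hS] at hs
        rcases hs with ⟨f, hf, rfl⟩ | ⟨⟨⟨f, hf⟩, w, hw⟩, rfl⟩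
        · exact absurd hadj not_subdiv2_adj_inl_inl
        · rw [SimpleGraph.adj_comm, hallZ', subdiv2_adj_inl_inr] at hadj
          cases hadj
      · exact Or.inr (Or.inr ⟨v, hx, rfl⟩)
      · exact Or.inr (Or.inl ⟨u, rfl⟩)
      · exact absurd h not_hallGraph_adj_inl_inl
      · refine Or.inl ⟨⟨⟨e, ?_⟩, x, hallGraph_adj_inl_inr.1 h⟩, rfl⟩
        obtain ⟨hx, s, hs, hadj⟩ := hx
        rw [hS] at hs
        rcases hs with ⟨f, hf, rfl⟩ | ⟨⟨⟨f, hf⟩, w, hw⟩, rfl⟩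
        · rw [subdiv2_adj_inl_inr] at hadj
          cases hadj
          exact hf
        · rw [hallZ', subdiv2_adj_inr_inr] at hadj
          cases hadj.2
          exact hf
      · obtain ⟨hx, s, hs, hadj⟩ := hx
        rw [hz] at hx
        rw [hS] at hs
        rcases hs with ⟨g, hg, rfl⟩ | ⟨⟨⟨g, hg⟩, y, hy⟩, rfl⟩
        · rw [subdiv2_adj_inl_inr] at hadj
          cases hadj
        · rw [hallZ', subdiv2_adj_inr_inr] at hadj
          cases hadj.1
      · exact absurd h not_hallGraph_adj_inr_inr
    · rintro (⟨⟨⟨e, he⟩, w, hw⟩, rfl⟩ | ⟨u, rfl⟩ | ⟨v, hv, rfl⟩)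
      · exact ⟨hZ _ _ _, _, he, subdiv2_adj_inl_inr.2 rfl⟩
      · obtain ⟨e, he⟩ := hFne
        exact (hBN _).2 ⟨e, he, trivial⟩
      · exact hv
  have hVinj : Function.Injective
      (fun v : V => (Sum.inl (Sum.inr (Sum.inl v)) : SubdivV (hallGraph G t))) :=
    Sum.inl_injective.comp (Sum.inr_injective.comp Sum.inl_injective)
  have hUinj : Function.Injective
      (fun u : Fin t => (Sum.inl (Sum.inr (Sum.inr u)) : SubdivV (hallGraph G t))) :=
    Sum.inl_injective.comp (Sum.inr_injective.comp Sum.inr_injective)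
  rw [hSA, Set.ncard_image_of_injective _ hinj]
  refine ⟨?_, ?_, ?_⟩
  · rw [hS, Set.ncard_union_eq ?_ (Set.toFinite _) (Set.toFinite _),
      Set.ncard_image_of_injective _ hinj, ← Nat.card_coe_set_eq (Set.range _),
      Nat.card_range_of_injective (hallZ'_injective G t F), card_sigma_hallInc]
    · ring
    · rw [Set.disjoint_left]
      rintro _ ⟨e, he, rfl⟩ ⟨p, hp⟩
      cases hp
  · rw [congrArg Set.ncard hN, Set.ncard_union_eq ?_ (Set.toFinite _) (Set.toFinite _),
      Set.ncard_union_eq ?_ (Set.toFinite _) (Set.toFinite _),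
      Set.ncard_image_of_injective _ hVinj, ← Nat.card_coe_set_eq (Set.range _),
      ← Nat.card_coe_set_eq (Set.range _),
      Nat.card_range_of_injective (hallZ_injective G t F), card_sigma_hallInc,
      Nat.card_range_of_injective hUinj, Nat.card_fin]
    · ring
    · rw [Set.disjoint_left]
      rintro _ ⟨u, rfl⟩ ⟨v, -, hv⟩
      cases hv
    · rw [Set.disjoint_left]
      rintro _ ⟨p, rfl⟩ (⟨u, hu⟩ | ⟨v, -, hv⟩)
      · cases hu
      · cases hv
  · ext v
    exact hBN (Sum.inl v)
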